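/- Let R ∈ ℝ^{2n×2n} be symmetric and K ∈ ℂ^{m×2n} of the passive form K = [M₁, iM₁, …, Mₙ, iMₙ]. Define A = 2Jₙ(R + Im(K†K)) and BBᵀ = 4Jₙ Re(K†K) Jₙᵀ. If A + Aᵀ + BBᵀ = 0, then JₙR = RJₙ, i.e., R is skew-Hamiltonian. -/

import Mathlib

open Matrix Kronecker Polynomial

/-- The 2×2 symplectic form matrix [[0,1],[-1,0]]. -/
noncomputable def Jb : Matrix (Fin 2) (Fin 2) ℝ := !![0, 1; -1, 0]

/-- Jₙ = Iₙ ⊗ J₁, indexed by pairs (block index, position within block). -/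
noncomputable def Jmat (n : ℕ) : Matrix (Fin n × Fin 2) (Fin n × Fin 2) ℝ :=
  (1 : Matrix (Fin n) (Fin n) ℝ) ⊗ₖ Jb

/-- Block-scalar diagonal matrix diag(σ₁I₂, …, σₙI₂). -/
noncomputable def SigmaD {n : ℕ} (σ : Fin n → ℝ) : Matrix (Fin n × Fin 2) (Fin n × Fin 2) ℝ :=
  Matrix.of fun p q => if p = q then σ p.1 else 0

theorem Jmat_transpose (n : ℕ) : (Jmat n)ᵀ = -Jmat n := by
  ext ⟨i, a⟩ ⟨j, b⟩
  fin_cases a <;> fin_cases b <;>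
    simp [Jmat, Jb, Matrix.one_apply, eq_comm]

theorem mul_Jmat_apply_zero {n m : ℕ} (X : Matrix (Fin m) (Fin n × Fin 2) ℝ) (l : Fin m)
    (j : Fin n) : (X * Jmat n) l (j, 0) = -X l (j, 1) := by
  simp [Matrix.mul_apply, Fintype.sum_prod_type, Jmat, Jb, Matrix.one_apply]

theorem mul_Jmat_apply_one {n m : ℕ} (X : Matrix (Fin m) (Fin n × Fin 2) ℝ) (l : Fin m)
    (j : Fin n) : (X * Jmat n) l (j, 1) = X l (j, 0) := by
  simp [Matrix.mul_apply, Fintype.sum_prod_type, Jmat, Jb, Matrix.one_apply]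

theorem stmt8 (n m : ℕ) (R : Matrix (Fin n × Fin 2) (Fin n × Fin 2) ℝ) (hR : R.IsSymm)
    (K : Matrix (Fin m) (Fin n × Fin 2) ℂ)
    (hK : ∀ (ℓ : Fin m) (j : Fin n), K ℓ (j, 1) = Complex.I * K ℓ (j, 0))
    (A BBt : Matrix (Fin n × Fin 2) (Fin n × Fin 2) ℝ)
    (hA : A = (2 : ℝ) • (Jmat n *
        (R + ((K.map Complex.re)ᵀ * K.map Complex.im - (K.map Complex.im)ᵀ * K.map Complex.re))))
    (hB : BBt = (4 : ℝ) • (Jmat n *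
        ((K.map Complex.re)ᵀ * K.map Complex.re + (K.map Complex.im)ᵀ * K.map Complex.im) * (Jmat n)ᵀ))
    (hLyap : A + Aᵀ + BBt = 0) :
    Jmat n * R = R * Jmat n := by
  have hXJ : K.map Complex.re * Jmat n = K.map Complex.im := by
    ext l ⟨j, b⟩
    fin_cases b
    · simp [mul_Jmat_apply_zero, hK]
    · simp [mul_Jmat_apply_one, hK]
  have hYJ : K.map Complex.im * Jmat n = -K.map Complex.re := by
    ext l ⟨j, b⟩
    fin_cases b
    · simp [mul_Jmat_apply_zero, hK]
    · simp [mul_Jmat_apply_one, hK]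
  generalize K.map Complex.re = X at *
  generalize K.map Complex.im = Y at *
  have hJ := Jmat_transpose n
  have hJX : Jmat n * Xᵀ = -Yᵀ := by
    rw [← hXJ, Matrix.transpose_mul, hJ, Matrix.neg_mul, neg_neg]
  have hJY : Jmat n * Yᵀ = Xᵀ := by
    rw [← neg_neg Xᵀ, ← Matrix.transpose_neg, ← hYJ, Matrix.transpose_mul, hJ, Matrix.neg_mul,
      neg_neg]
  have hA' : A = (2 : ℝ) • (Jmat n * R - (Xᵀ * X + Yᵀ * Y)) := by
    rw [hA, Matrix.mul_add, Matrix.mul_sub, ← Matrix.mul_assoc, ← Matrix.mul_assoc, hJX, hJY,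
      Matrix.neg_mul]
    congr 1
    abel
  have hB' : BBt = (4 : ℝ) • (Xᵀ * X + Yᵀ * Y) := by
    rw [hB, hJ, Matrix.mul_add, ← Matrix.mul_assoc, ← Matrix.mul_assoc, hJX, hJY, Matrix.add_mul,
      Matrix.mul_neg, Matrix.mul_neg, Matrix.mul_assoc, Matrix.mul_assoc, hXJ, hYJ]
    simp [add_comm]
  have hAt : Aᵀ = (2 : ℝ) • (-(R * Jmat n) - (Xᵀ * X + Yᵀ * Y)) := by
    simp [hA', hJ, hR.eq]
  rw [hAt, hA', hB'] at hLyap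
  have key : (2 : ℝ) • (Jmat n * R - R * Jmat n) = 0 := by
    rw [← hLyap]
    module
  exact sub_eq_zero.mp ((smul_eq_zero.mp key).resolve_left two_ne_zero)
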